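/- Assume β ≥ 1. Let f : Q → ℝ be continuous and obey the parabolic growth condition, let ψ be continuous on Q ∪ ∂¹Q and obey the parabolic growth condition, and let g : ∂¹Q → ℝ be continuous, obey the parabolic growth condition, and satisfy ψ ≤ g on ∂¹Q. If u₁ and u₂ are both continuous on Q ∪ ∂¹Q, belong to C²(Q), each uᵢ and A uᵢ obey the parabolic growth condition on Q, and each uᵢ satisfies min{−∂_t uᵢ + A uᵢ − f, uᵢ − ψ} = 0 on Q and uᵢ = g on ∂¹Q (i = 1, 2), then u₁ = u₂ on Q ∪ ∂¹Q. -/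

import Mathlib

open Real Set MeasureTheory

noncomputable section

/-- First directional derivative of `u` at `z` in direction `v`. -/
def D1 (u : ℝ × ℝ → ℝ) (z v : ℝ × ℝ) : ℝ := fderiv ℝ u z v

/-- Second directional derivative of `u` at `z` in directions `v`, `w`. -/
def D2 (u : ℝ × ℝ → ℝ) (z v w : ℝ × ℝ) : ℝ := fderiv ℝ (fun z' => fderiv ℝ u z' v) z w

/-- The elliptic Heston operator
`(Au)(x,y) = −(y/2)(u_xx + 2ρσ u_xy + σ² u_yy) − (r − q − y/2) u_x − κ(θ − y) u_y + r u`. -/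
def hestonA (σ ρ κ θ q r : ℝ) (u : ℝ × ℝ → ℝ) (z : ℝ × ℝ) : ℝ :=
  -(z.2 / 2) * (D2 u z (1, 0) (1, 0) + 2 * ρ * σ * D2 u z (1, 0) (0, 1)
      + σ ^ 2 * D2 u z (0, 1) (0, 1))
    - (r - q - z.2 / 2) * D1 u z (1, 0) - κ * (θ - z.2) * D1 u z (0, 1) + r * u z

/-- The open upper half-plane `ℍ = ℝ × (0,∞)`. -/
def HH : Set (ℝ × ℝ) := {z | 0 < z.2}

/-- `Γ₁ = ∂O ∩ ℍ`. -/
def Gamma1 (O : Set (ℝ × ℝ)) : Set (ℝ × ℝ) := frontier O ∩ HH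

/-- `Γ₀`: the interior, relative to `∂ℍ = ℝ × {0}`, of `∂ℍ ∩ ∂O`. -/
def Gamma0 (O : Set (ℝ × ℝ)) : Set (ℝ × ℝ) :=
  {z | z.2 = 0 ∧ z.1 ∈ interior {x : ℝ | (x, (0 : ℝ)) ∈ frontier O}}

/-- The elliptic growth condition: `|v(x,y)| ≤ C (1 + e^{M₁ y} + e^{M₂ x})` on `S`,
with `0 ≤ M₁ < min (r/(κθ)) μ`, `μ = 2κ/σ²`, and `M₂ ∈ [0,1)`. -/
def ellGrowth (σ κ θ r : ℝ) (S : Set (ℝ × ℝ)) (v : ℝ × ℝ → ℝ) : Prop :=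
  ∃ C M₁ M₂ : ℝ, 0 < C ∧ 0 ≤ M₁ ∧ M₁ < min (r / (κ * θ)) (2 * κ / σ ^ 2) ∧
    0 ≤ M₂ ∧ M₂ < 1 ∧ ∀ z ∈ S, |v z| ≤ C * (1 + exp (M₁ * z.2) + exp (M₂ * z.1))

/-- Time derivative `u_t` at `p = (t, z)`. -/
def Dt (u : ℝ × (ℝ × ℝ) → ℝ) (p : ℝ × (ℝ × ℝ)) : ℝ := deriv (fun s => u (s, p.2)) p.1

/-- The Heston operator acting in the spatial variables for each fixed time. -/
def hestonP (σ ρ κ θ q r : ℝ) (u : ℝ × (ℝ × ℝ) → ℝ) (p : ℝ × (ℝ × ℝ)) : ℝ :=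
  hestonA σ ρ κ θ q r (fun z => u (p.1, z)) p.2

/-- The parabolic cylinder `Q = (0,T) × O`. -/
def parQ (T : ℝ) (O : Set (ℝ × ℝ)) : Set (ℝ × (ℝ × ℝ)) := Ioo (0 : ℝ) T ×ˢ O

/-- The partial parabolic boundary `∂¹Q = (0,T) × Γ₁ ∪ {T} × (O ∪ Γ₁)`. -/
def parB1 (T : ℝ) (O : Set (ℝ × ℝ)) : Set (ℝ × (ℝ × ℝ)) :=
  Ioo (0 : ℝ) T ×ˢ Gamma1 O ∪ ({T} : Set ℝ) ×ˢ (O ∪ Gamma1 O)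

/-- The full parabolic boundary `∂Q = (0,T) × ∂O ∪ {T} × cl(O)`. -/
def parB (T : ℝ) (O : Set (ℝ × ℝ)) : Set (ℝ × (ℝ × ℝ)) :=
  Ioo (0 : ℝ) T ×ˢ frontier O ∪ ({T} : Set ℝ) ×ˢ closure O

/-- The parabolic growth condition: `|v(t,x,y)| ≤ C (1 + e^{M₁ y} + e^{M₂ x})` on `S`,
with `0 ≤ M₁ < μ = 2κ/σ²` and `M₂ ∈ [0,1]`. -/
def parabGrowth (σ κ : ℝ) (S : Set (ℝ × (ℝ × ℝ))) (v : ℝ × (ℝ × ℝ) → ℝ) : Prop :=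
  ∃ C M₁ M₂ : ℝ, 0 < C ∧ 0 ≤ M₁ ∧ M₁ < 2 * κ / σ ^ 2 ∧ 0 ≤ M₂ ∧ M₂ ≤ 1 ∧
    ∀ p ∈ S, |v p| ≤ C * (1 + exp (M₁ * p.2.2) + exp (M₂ * p.2.1))

/-- `u ∈ C²(Q)`: the time derivative `u_t` and the spatial derivatives `Du`, `D²u` exist
and are continuous on `Q`. -/
def C2Parab (Q : Set (ℝ × (ℝ × ℝ))) (u : ℝ × (ℝ × ℝ) → ℝ) : Prop :=
  (∀ p ∈ Q, DifferentiableAt ℝ (fun s => u (s, p.2)) p.1) ∧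
  ContinuousOn (fun p => Dt u p) Q ∧
  (∀ p ∈ Q, DifferentiableAt ℝ (fun z => u (p.1, z)) p.2) ∧
  ContinuousOn (fun p => fderiv ℝ (fun z => u (p.1, z)) p.2) Q ∧
  (∀ p ∈ Q, DifferentiableAt ℝ (fun z => fderiv ℝ (fun z' => u (p.1, z')) z) p.2) ∧
  ContinuousOn (fun p => fderiv ℝ (fun z => fderiv ℝ (fun z' => u (p.1, z')) z) p.2) Q

/-- `min{−u_t + Au − f, u − ψ} = 0` on `Q`: `−u_t + Au ≥ f` and `u ≥ ψ` on `Q`, and at each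
point of `Q` at least one of `−u_t + Au = f`, `u = ψ` holds. -/
def parabObstacleProblem (σ ρ κ θ q r : ℝ) (Q : Set (ℝ × (ℝ × ℝ)))
    (f ψ u : ℝ × (ℝ × ℝ) → ℝ) : Prop :=
  ∀ p ∈ Q, f p ≤ -Dt u p + hestonP σ ρ κ θ q r u p ∧ ψ p ≤ u p ∧
    (-Dt u p + hestonP σ ρ κ θ q r u p = f p ∨ u p = ψ p)

/-- Second-order necessary condition at a local maximum in one variable. -/
lemma local_max_second {g g' : ℝ → ℝ} {c : ℝ} (hmax : IsLocalMax g 0)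
    (h1 : ∀ᶠ s in nhds (0 : ℝ), HasDerivAt g (g' s) s) (h2 : HasDerivAt g' c 0) :
    g' 0 = 0 ∧ c ≤ 0 := by
  have h0 : HasDerivAt g (g' 0) 0 := h1.self_of_nhds
  have hz : g' 0 = 0 := hmax.hasDerivAt_eq_zero h0
  refine ⟨hz, ?_⟩
  by_contra hc
  push Not at hc
  have hd : deriv g =ᶠ[nhds 0] g' := h1.mono fun s hs => hs.deriv
  have hdd : deriv (deriv g) 0 = c := by
    rw [hd.deriv_eq]; exact h2.deriv
  have hmin : IsLocalMin g 0 :=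
    isLocalMin_of_deriv_deriv_pos (by rw [hdd]; exact hc) (by rw [h0.deriv, hz]) h0.continuousAt
  have hconst : g =ᶠ[nhds 0] fun _ => g 0 := by
    filter_upwards [hmax, hmin] with s hs1 hs2
    exact le_antisymm hs1 hs2
  have hd0 : deriv g =ᶠ[nhds 0] fun _ => 0 := by
    filter_upwards [hconst.eventuallyEq_nhds] with s hs
    rw [hs.deriv_eq]; simp
  have : deriv (deriv g) 0 = 0 := by
    rw [hd0.deriv_eq]; simp
  linarith

lemma slice_deriv {u : ℝ × ℝ → ℝ} {O : Set (ℝ × ℝ)} (hO : IsOpen O) {z : ℝ × ℝ} (hz : z ∈ O)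
    (h1 : ∀ w ∈ O, DifferentiableAt ℝ u w)
    (h2 : DifferentiableAt ℝ (fun w => fderiv ℝ u w) z) (d : ℝ × ℝ) :
    (∀ᶠ s in nhds (0 : ℝ),
      HasDerivAt (fun s : ℝ => u (z + s • d)) (fderiv ℝ u (z + s • d) d) s) ∧
    HasDerivAt (fun s : ℝ => fderiv ℝ u (z + s • d) d)
      (fderiv ℝ (fun w => fderiv ℝ u w) z d d) 0 := by
  have hline : ∀ s : ℝ, HasDerivAt (fun s : ℝ => z + s • d) d s := by
    intro s
    have := ((hasDerivAt_id s).smul_const d).const_add z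
    simpa using this
  have hz0 : z + (0 : ℝ) • d = z := by simp
  constructor
  · have hc : ContinuousAt (fun s : ℝ => z + s • d) 0 := (hline 0).continuousAt
    have : ∀ᶠ s in nhds (0 : ℝ), z + s • d ∈ O := by
      apply hc.eventually_mem
      rw [hz0]; exact hO.mem_nhds hz
    filter_upwards [this] with s hs
    exact (h1 _ hs).hasFDerivAt.comp_hasDerivAt s (hline s)
  · have h3 : HasFDerivAt (fun w => fderiv ℝ u w) (fderiv ℝ (fun w => fderiv ℝ u w) z)
        (z + (0 : ℝ) • d) := by rw [hz0]; exact h2.hasFDerivAt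
    have h4 := h3.comp_hasDerivAt 0 (hline 0)
    have := h4.clm_apply (hasDerivAt_const (0 : ℝ) d)
    simpa using this

lemma D2_eq {u : ℝ × ℝ → ℝ} {z : ℝ × ℝ}
    (h2 : DifferentiableAt ℝ (fun w => fderiv ℝ u w) z) (v w : ℝ × ℝ) :
    D2 u z v w = fderiv ℝ (fun w => fderiv ℝ u w) z w v := by
  unfold D2
  have := (h2.hasFDerivAt.clm_apply (hasFDerivAt_const v z)).fderiv
  rw [this]; simp

/-- The Heston operator written through a sum of two squares. -/
lemma hestonA_eq (σ ρ κ θ q r : ℝ) {u : ℝ × ℝ → ℝ} {O : Set (ℝ × ℝ)} (hO : IsOpen O)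
    {z : ℝ × ℝ} (hz : z ∈ O) (h1 : ∀ w ∈ O, DifferentiableAt ℝ u w)
    (h2 : DifferentiableAt ℝ (fun w => fderiv ℝ u w) z) :
    hestonA σ ρ κ θ q r u z =
      -(z.2 / 2) * (fderiv ℝ (fun w => fderiv ℝ u w) z (1, ρ * σ) (1, ρ * σ)
        + σ ^ 2 * (1 - ρ ^ 2) * fderiv ℝ (fun w => fderiv ℝ u w) z (0, 1) (0, 1))
      - (r - q - z.2 / 2) * fderiv ℝ u z (1, 0) - κ * (θ - z.2) * fderiv ℝ u z (0, 1)
      + r * u z := by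
  have hsym : ∀ v w, fderiv ℝ (fun w => fderiv ℝ u w) z v w
      = fderiv ℝ (fun w => fderiv ℝ u w) z w v := by
    apply second_derivative_symmetric_of_eventually (f := u) (f' := fun w => fderiv ℝ u w)
    · filter_upwards [hO.mem_nhds hz] with w hw using (h1 w hw).hasFDerivAt
    · exact h2.hasFDerivAt
  unfold hestonA D1
  rw [D2_eq h2, D2_eq h2, D2_eq h2]
  have hd : ((1, ρ * σ) : ℝ × ℝ) = (1, 0) + (ρ * σ) • (0, 1) := by simp
  rw [hd]
  simp only [map_add, map_smul, _root_.add_apply, _root_.smul_apply,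
    smul_eq_mul]
  rw [hsym (1, 0) (0, 1)]
  ring

/-- The spatial part of the barrier at frozen coefficient `n`. -/
def barS (δ M n : ℝ) (x y : ℝ) : ℝ :=
  exp ((1 + δ) * x + n * y) + exp (-δ * x + n * y) + 2 * exp (M * y) - log y

def barS1 (δ M n a b : ℝ) (x y : ℝ) : ℝ :=
  ((1 + δ) * a + n * b) * exp ((1 + δ) * x + n * y)
    + (-δ * a + n * b) * exp (-δ * x + n * y) + 2 * (M * b) * exp (M * y) - b / y

def barS2 (δ M n a b : ℝ) (x y : ℝ) : ℝ :=
  ((1 + δ) * a + n * b) ^ 2 * exp ((1 + δ) * x + n * y)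
    + (-δ * a + n * b) ^ 2 * exp (-δ * x + n * y) + 2 * (M * b) ^ 2 * exp (M * y) + b ^ 2 / y ^ 2

lemma hasDerivAt_exp_line (k c s : ℝ) :
    HasDerivAt (fun s : ℝ => exp (c + k * s)) (k * exp (c + k * s)) s := by
  have h := (((hasDerivAt_id s).const_mul k).const_add c).exp
  simp only [id] at h
  convert h using 1; ring

lemma barS_deriv (δ M n a b x y : ℝ) (hy : 0 < y) :
    (∀ᶠ s in nhds (0 : ℝ), HasDerivAt (fun s : ℝ => barS δ M n (x + s * a) (y + s * b))
      (barS1 δ M n a b (x + s * a) (y + s * b)) s) ∧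
    HasDerivAt (fun s : ℝ => barS1 δ M n a b (x + s * a) (y + s * b))
      (barS2 δ M n a b x y) 0 := by
  have e1 : ∀ s, (1 + δ) * (x + s * a) + n * (y + s * b)
      = ((1 + δ) * x + n * y) + ((1 + δ) * a + n * b) * s := by intro s; ring
  have e2 : ∀ s, -δ * (x + s * a) + n * (y + s * b)
      = (-δ * x + n * y) + (-δ * a + n * b) * s := by intro s; ring
  have e3 : ∀ s, M * (y + s * b) = M * y + (M * b) * s := by intro s; ring
  have hl : ∀ s : ℝ, HasDerivAt (fun s : ℝ => y + s * b) b s := by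
    intro s
    simpa using ((hasDerivAt_id s).mul_const b).const_add y
  constructor
  · have hpos : ∀ᶠ s in nhds (0 : ℝ), 0 < y + s * b := by
      apply (hl 0).continuousAt.eventually_mem (s := Ioi 0)
      apply Ioi_mem_nhds; simpa using hy
    filter_upwards [hpos] with s hs
    unfold barS barS1
    simp only [e1, e2, e3]
    have h := (((hasDerivAt_exp_line ((1 + δ) * a + n * b) ((1 + δ) * x + n * y) s).add
      (hasDerivAt_exp_line (-δ * a + n * b) (-δ * x + n * y) s)).add
      ((hasDerivAt_exp_line (M * b) (M * y) s).const_mul 2)).sub ((hl s).log hs.ne')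
    exact h.congr_deriv (by ring)
  · unfold barS1 barS2
    simp only [e1, e2, e3]
    have h := ((((hasDerivAt_exp_line ((1 + δ) * a + n * b) ((1 + δ) * x + n * y) 0).const_mul
        ((1 + δ) * a + n * b)).add
      ((hasDerivAt_exp_line (-δ * a + n * b) (-δ * x + n * y) 0).const_mul (-δ * a + n * b))).add
      ((hasDerivAt_exp_line (M * b) (M * y) 0).const_mul (2 * (M * b)))).sub
      ((hasDerivAt_const (0 : ℝ) b).div (hl 0) (by simpa using hy.ne'))
    exact h.congr_deriv (by simp; ring)

/-- Algebra for one exponential piece. -/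
lemma exp_piece {σ ρ κ θ q r L l n m y w t : ℝ} (hρ₁ : -1 < ρ) (hρ₂ : ρ < 1)
    (hκ : 0 < κ) (hθ : 0 < θ) (hn : 0 < n) (hn1 : n ≤ 1) (hy : 0 < y) (hw : 0 < w)
    (hm : |m| ≤ 2) (hmn : (m ^ 2 - m) / 2 ≤ n)
    (hL : L = 1 + 2 * |ρ * σ| + σ ^ 2)
    (hl : 2 * |r - q| + κ * θ ≤ l + r) :
    0 ≤ L * n * y * w - y / 2 * ((m + n * (ρ * σ)) ^ 2 * w + σ ^ 2 * (1 - ρ ^ 2) * (n ^ 2 * w))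
      - (r - q - y / 2) * (m * w) - κ * (θ - y) * (n * w) + (l + r) * w := by
  have h1 : ρ * σ * m ≤ 2 * |ρ * σ| := by
    calc ρ * σ * m ≤ |ρ * σ * m| := le_abs_self _
      _ = |ρ * σ| * |m| := abs_mul _ _
      _ ≤ |ρ * σ| * 2 := by gcongr
      _ = _ := by ring
  have h2 : (r - q) * m ≤ 2 * |r - q| := by
    calc (r - q) * m ≤ |(r - q) * m| := le_abs_self _
      _ = |r - q| * |m| := abs_mul _ _
      _ ≤ |r - q| * 2 := by gcongr
      _ = _ := by ring
  have h3 : κ * θ * n ≤ κ * θ := mul_le_of_le_one_right (by positivity) hn1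
  have h4 : σ ^ 2 * n ^ 2 ≤ σ ^ 2 * n * 2 := by
    have : n ^ 2 ≤ n := by nlinarith
    nlinarith [sq_nonneg σ, mul_nonneg (sq_nonneg σ) hn.le, mul_le_mul_of_nonneg_left this (sq_nonneg σ)]
  have hcoef : 0 ≤ L * n - ((m ^ 2 - m) / 2 + ρ * σ * m * n + σ ^ 2 * n ^ 2 / 2 - κ * n) := by
    rw [hL]
    have := mul_le_mul_of_nonneg_right h1 hn.le
    nlinarith [mul_pos hκ hn]
  have hconst : 0 ≤ (l + r) - (r - q) * m - κ * θ * n := by linarith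
  have : 0 ≤ w * (y * (L * n - ((m ^ 2 - m) / 2 + ρ * σ * m * n + σ ^ 2 * n ^ 2 / 2 - κ * n))
      + ((l + r) - (r - q) * m - κ * θ * n)) := by positivity
  calc 0 ≤ _ := this
    _ = _ := by ring

/-- The barrier is a strict supersolution. -/
lemma barrier_super {σ ρ κ θ q r L l n δ M K x y t : ℝ} (hσ : σ ≠ 0)
    (hρ₁ : -1 < ρ) (hρ₂ : ρ < 1)
    (hκ : 0 < κ) (hθ : 0 < θ) (hβ : 1 ≤ 2 * κ * θ / σ ^ 2)
    (hn : 0 < n) (hn1 : n ≤ 1) (hy : 0 < y) (ht : 0 < t)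
    (hδ : 0 < δ) (hδ1 : δ ≤ 1 / 2) (hδn : δ ≤ n)
    (hM : 0 < M) (hMμ : M < 2 * κ / σ ^ 2)
    (hK : 1 ≤ exp (M * y) - log y + K)
    (hL : L = 1 + 2 * |ρ * σ| + σ ^ 2)
    (hl : 2 * |r - q| + κ * θ + 2 * κ * θ * M + κ + 1 ≤ l + r) :
    0 < (L * n * y * (exp ((1 + δ) * x + n * y) + exp (-δ * x + n * y)) + 1 / t ^ 2)
      - y / 2 * (barS2 δ M n 1 (ρ * σ) x y + σ ^ 2 * (1 - ρ ^ 2) * barS2 δ M n 0 1 x y)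
      - (r - q - y / 2) * barS1 δ M n 1 0 x y - κ * (θ - y) * barS1 δ M n 0 1 x y
      + (l + r) * (barS δ M n x y + K + 1 / t) := by
  have hl' : 2 * |r - q| + κ * θ ≤ l + r := by
    have : 0 < κ * θ * M := by positivity
    linarith
  have p1 := exp_piece (σ := σ) (L := L) (m := 1 + δ) (w := exp ((1 + δ) * x + n * y)) (t := t)
    hρ₁ hρ₂ hκ hθ hn hn1 hy (exp_pos _)
    (by rw [abs_of_pos (by linarith)]; linarith) (by nlinarith) hL hl'
  have p2 := exp_piece (σ := σ) (L := L) (m := -δ) (w := exp (-δ * x + n * y)) (t := t)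
    hρ₁ hρ₂ hκ hθ hn hn1 hy (exp_pos _)
    (by rw [abs_neg, abs_of_pos (by linarith)]; linarith) (by nlinarith) hL hl'
  have hσ2 : 0 < σ ^ 2 := by positivity
  have hb : σ ^ 2 / 2 ≤ κ * θ := by
    rw [le_div_iff₀ hσ2] at hβ; linarith
  have hMs : σ ^ 2 * M ≤ 2 * κ := by
    rw [lt_div_iff₀ hσ2] at hMμ; linarith
  set e := exp (M * y) with he
  have hepos : 0 < e := exp_pos _
  have hlr : 0 ≤ l + r := by have := abs_nonneg (r - q); have : 0 < κ * θ := by positivity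
                             linarith
  -- exponential and logarithmic part
  have p3 : 0 < - y / 2 * (σ ^ 2 * (2 * M ^ 2 * e + 1 / y ^ 2)) - κ * (θ - y) * (2 * M * e - 1 / y)
      + (l + r) * (2 * e - log y + K) := by
    have i1 : 0 ≤ (2 * e * M * y) * (κ - σ ^ 2 * M / 2) :=
      mul_nonneg (by positivity) (by linarith)
    have i2 : 0 ≤ (κ * θ - σ ^ 2 / 2) * (1 / y) := mul_nonneg (by linarith) (by positivity)
    have i3 : (2 * κ * θ * M + κ + 1) * (1 + e) ≤ (l + r) * (2 * e - log y + K) := by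
      apply mul_le_mul _ (by linarith) (by positivity) hlr
      have := abs_nonneg (r - q)
      have : 0 < κ * θ := by positivity
      linarith
    have i4 : 0 < κ * θ * M := by positivity
    have : - y / 2 * (σ ^ 2 * (2 * M ^ 2 * e + 1 / y ^ 2)) - κ * (θ - y) * (2 * M * e - 1 / y)
       = (2 * e * M * y) * (κ - σ ^ 2 * M / 2) + (κ * θ - σ ^ 2 / 2) * (1 / y)
         - 2 * κ * θ * M * e - κ := by
      field_simp; ring
    rw [this]
    nlinarith [mul_pos hκ hepos]
  have p4 : 0 ≤ 1 / t ^ 2 + (l + r) * (1 / t) := by positivity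
  have := add_pos_of_nonneg_of_pos (add_nonneg (add_nonneg p1 p2) p4) p3
  unfold barS barS1 barS2
  rw [← he]
  calc 0 < _ := this
    _ = _ := by ring

/-- A faster exponential dominates a slower one. -/
lemma exp_dom {a b C η : ℝ} (ha : 0 ≤ a) (hab : a < b) (hC : 0 < C) (hη : 0 < η) :
    ∃ C' : ℝ, ∀ x : ℝ, C * exp (a * x) ≤ η * exp (b * x) + C' := by
  refine ⟨C * exp (a * (log (C / η) / (b - a))), fun x => ?_⟩
  have hba : 0 < b - a := by linarith
  rcases le_total (log (C / η)) ((b - a) * x) with h | h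
  · have h1 : C / η ≤ exp ((b - a) * x) := by
      rw [← log_le_iff_le_exp (by positivity)]; exact h
    have h2 : C ≤ η * exp ((b - a) * x) := by
      rw [div_le_iff₀ hη] at h1; linarith
    have h3 : C * exp (a * x) ≤ η * exp ((b - a) * x) * exp (a * x) := by gcongr
    have h4 : exp ((b - a) * x) * exp (a * x) = exp (b * x) := by
      rw [← exp_add]; congr 1; ring
    rw [mul_assoc, h4] at h3
    have : 0 < C * exp (a * (log (C / η) / (b - a))) := by positivity
    linarith
  · have h1 : x ≤ log (C / η) / (b - a) := by
      rw [le_div_iff₀ hba]; linarith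
    have h2 : C * exp (a * x) ≤ C * exp (a * (log (C / η) / (b - a))) := by gcongr
    have : 0 < η * exp (b * x) := by positivity
    linarith

/-- Coercivity: positivity of the test function confines the point to a compact box. -/
lemma box_bound {C M₁ M δ η K : ℝ} (hC : 0 < C) (hM₁ : 0 ≤ M₁) (hM : M₁ < M) (hδ : 0 < δ)
    (hη : 0 < η) (hK : ∀ y : ℝ, 0 < y → 1 ≤ exp (M * y) - log y + K) :
    ∃ R : ℝ, 0 < R ∧ ∀ t x y n : ℝ, 0 < t → 0 < y → 0 ≤ n →
      η * (barS δ M n x y + K + 1 / t) < C * (1 + exp (M₁ * y) + exp x) →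
      1 / R ≤ t ∧ -R ≤ x ∧ x ≤ R ∧ exp (-R) ≤ y ∧ y ≤ R := by
  obtain ⟨C1, hC1⟩ := exp_dom (a := 1) (b := 1 + δ) zero_le_one (by linarith) hC (half_pos hη)
  obtain ⟨C2, hC2⟩ := exp_dom hM₁ hM hC (half_pos hη)
  have hMp : 0 < M := by linarith
  -- a common bound
  set c := 2 * (|C| + |C1| + |C2| + |η * K| + η) / η with hc
  have hcpos : 0 < c := by positivity
  refine ⟨c + |K| + c / δ + c / M + 1, by positivity, ?_⟩
  intro t x y n ht hy hn h
  have hKy := hK y hy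
  have g1 := hC1 x
  have g2 := hC2 y
  rw [one_mul] at g1
  have b1 : exp ((1 + δ) * x) ≤ exp ((1 + δ) * x + n * y) := by
    gcongr; nlinarith [mul_nonneg hn hy.le]
  have b2 : exp (-δ * x) ≤ exp (-δ * x + n * y) := by
    gcongr; nlinarith [mul_nonneg hn hy.le]
  have e1 := exp_pos ((1 + δ) * x)
  have e2 := exp_pos (-δ * x)
  have e3 := exp_pos (M * y)
  have ht' : 0 < 1 / t := by positivity
  have key : η / 2 * exp ((1 + δ) * x) + η * exp (-δ * x) + η / 2 * exp (M * y)
      + η * (exp (M * y) - log y + K) + η * (1 / t) ≤ C + C1 + C2 := by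
    unfold barS at h
    have b1' := mul_le_mul_of_nonneg_left b1 hη.le
    have b2' := mul_le_mul_of_nonneg_left b2 hη.le
    linarith
  have hcη : C + C1 + C2 ≤ η / 2 * c := by
    rw [hc]
    have : η / 2 * (2 * (|C| + |C1| + |C2| + |η * K| + η) / η)
      = |C| + |C1| + |C2| + |η * K| + η := by field_simp
    rw [this]
    have := le_abs_self C
    have := le_abs_self C1
    have := le_abs_self C2
    have := abs_nonneg (η * K)
    linarith
  have key2 : 1 / 2 * exp ((1 + δ) * x) + exp (-δ * x) + 1 / 2 * exp (M * y)
      + (exp (M * y) - log y + K) + 1 / t ≤ c / 2 := by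
    have : η * (1 / 2 * exp ((1 + δ) * x) + exp (-δ * x) + 1 / 2 * exp (M * y)
      + (exp (M * y) - log y + K) + 1 / t) ≤ η * (c / 2) := by linarith
    exact le_of_mul_le_mul_left this hη
  have k1 : exp ((1 + δ) * x) ≤ c := by linarith
  have k2 : exp (-δ * x) ≤ c := by linarith
  have k3 : exp (M * y) ≤ c := by linarith
  have k4 : - log y ≤ c + |K| := by
    have := neg_abs_le K
    linarith
  have k5 : 1 / t ≤ c := by linarith
  have l1 := add_one_le_exp ((1 + δ) * x)
  have l2 := add_one_le_exp (-δ * x)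
  have l3 := add_one_le_exp (M * y)
  have q1 : 0 < c / δ := by positivity
  have q2 : 0 < c / M := by positivity
  have q3 := abs_nonneg K
  refine ⟨?_, ?_, ?_, ?_, ?_⟩
  · rw [div_le_comm₀ (by positivity) ht]; linarith
  · have : -x ≤ c / δ := by rw [le_div_iff₀ hδ]; linarith
    linarith
  · have : x ≤ c := by
      by_contra hx
      push Not at hx
      nlinarith
    linarith
  · rw [← le_log_iff_exp_le hy]; linarith
  · have : y ≤ c / M := by rw [le_div_iff₀ hMp]; linarith
    linarith

lemma growth_combine {C C' m m' M a a' x y : ℝ} (hC : 0 < C) (hC' : 0 < C')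
    (hm : m ≤ M) (hm' : m' ≤ M) (hy : 0 < y) (ha : 0 ≤ a) (ha1 : a ≤ 1)
    (ha' : 0 ≤ a') (ha1' : a' ≤ 1) :
    C * (1 + exp (m * y) + exp (a * x)) + C' * (1 + exp (m' * y) + exp (a' * x))
      ≤ 2 * (C + C') * (1 + exp (M * y) + exp x) := by
  have key : ∀ a : ℝ, 0 ≤ a → a ≤ 1 → exp (a * x) ≤ 1 + exp x := by
    intro a ha ha1
    rcases le_total 0 x with hx | hx
    · have : exp (a * x) ≤ exp x := by
        gcongr; nlinarith
      linarith
    · have : exp (a * x) ≤ 1 := by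
        rw [exp_le_one_iff]; nlinarith
      linarith [exp_pos x]
  have h1 := key a ha ha1
  have h2 := key a' ha' ha1'
  have h3 : exp (m * y) ≤ exp (M * y) := by gcongr
  have h4 : exp (m' * y) ≤ exp (M * y) := by gcongr
  have e := exp_pos (M * y)
  have e' := exp_pos x
  have : C * (1 + exp (m * y) + exp (a * x)) ≤ C * (2 * (1 + exp (M * y) + exp x)) := by
    gcongr; linarith
  have : C' * (1 + exp (m' * y) + exp (a' * x)) ≤ C' * (2 * (1 + exp (M * y) + exp x)) := by
    gcongr; linarith
  linarith

lemma log_bound {M : ℝ} (hM : 0 < M) (y : ℝ) (hy : 0 < y) :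
    1 ≤ exp (M * y) - log y + (-1 - log M) := by
  have h1 := log_le_sub_one_of_pos (mul_pos hM hy)
  rw [log_mul hM.ne' hy.ne'] at h1
  have h2 := add_one_le_exp (M * y)
  linarith

/-- The domain on which the data live, as a product. -/
lemma parS_eq {T : ℝ} (hT : 0 < T) (O : Set (ℝ × ℝ)) (hOsub : O ⊆ HH) :
    parQ T O ∪ parB1 T O = Ioc 0 T ×ˢ (closure O ∩ HH) := by
  have hcl : closure O ∩ HH = O ∪ Gamma1 O := by
    rw [closure_eq_self_union_frontier, union_inter_distrib_right, inter_eq_left.mpr hOsub]; rfl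
  rw [hcl]
  ext ⟨t, z⟩
  simp only [parQ, parB1, mem_union, mem_prod, mem_Ioo, mem_Ioc, mem_singleton_iff]
  constructor
  · rintro (⟨⟨h1, h2⟩, h3⟩ | ⟨⟨h1, h2⟩, h3⟩ | ⟨rfl, h3⟩)
    · exact ⟨⟨h1, h2.le⟩, Or.inl h3⟩
    · exact ⟨⟨h1, h2.le⟩, Or.inr h3⟩
    · exact ⟨⟨hT, le_rfl⟩, h3⟩
  · rintro ⟨⟨h1, h2⟩, h3⟩
    rcases h2.lt_or_eq with h | h
    · rcases h3 with h3 | h3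
      · exact Or.inl ⟨⟨h1, h⟩, h3⟩
      · exact Or.inr (Or.inl ⟨⟨h1, h⟩, h3⟩)
    · exact Or.inr (Or.inr ⟨h, h3⟩)

set_option maxHeartbeats 2000000 in
/-- The difference with the barrier cannot have a positive interior maximum. -/
lemma no_interior_max {σ ρ κ θ q r L l δ M K η T : ℝ} (hσ : σ ≠ 0)
    (hρ₁ : -1 < ρ) (hρ₂ : ρ < 1)
    (hκ : 0 < κ) (hθ : 0 < θ) (hβ : 1 ≤ 2 * κ * θ / σ ^ 2)
    (hδ : 0 < δ) (hδ1 : δ ≤ 1 / 2) (hδT : δ ≤ exp (-L * T))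
    (hM : 0 < M) (hMμ : M < 2 * κ / σ ^ 2)
    (hK : ∀ y : ℝ, 0 < y → 1 ≤ exp (M * y) - log y + K)
    (hL : L = 1 + 2 * |ρ * σ| + σ ^ 2)
    (hl : 2 * |r - q| + κ * θ + 2 * κ * θ * M + κ + 1 ≤ l + r) (hη : 0 < η)
    {O : Set (ℝ × ℝ)} (hO : IsOpen O) (hOsub : O ⊆ HH) {u₁ u₂ : ℝ × (ℝ × ℝ) → ℝ}
    (hu₁d : C2Parab (parQ T O) u₁) (hu₂d : C2Parab (parQ T O) u₂)
    {p : ℝ × (ℝ × ℝ)} (hp : p ∈ parQ T O)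
    (hsub : -Dt u₁ p + hestonP σ ρ κ θ q r u₁ p ≤ -Dt u₂ p + hestonP σ ρ κ θ q r u₂ p)
    (hpos : 0 < exp (l * (p.1 - T)) * (u₁ p - u₂ p)
      - η * (barS δ M (exp (-L * p.1)) p.2.1 p.2.2 + K + 1 / p.1))
    (hmax : ∀ z ∈ parQ T O, exp (l * (z.1 - T)) * (u₁ z - u₂ z)
        - η * (barS δ M (exp (-L * z.1)) z.2.1 z.2.2 + K + 1 / z.1)
      ≤ exp (l * (p.1 - T)) * (u₁ p - u₂ p)
        - η * (barS δ M (exp (-L * p.1)) p.2.1 p.2.2 + K + 1 / p.1)) : False := by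
  obtain ⟨t, x, y⟩ := p
  obtain ⟨⟨ht0, htT⟩, hz⟩ := hp
  simp only at ht0 htT hz hpos
  have hy : 0 < y := hOsub hz
  have hLp : 0 < L := by rw [hL]; positivity
  set n := exp (-L * t) with hn
  set E := exp (l * (t - T)) with hE
  have hEp : 0 < E := exp_pos _
  have hnp : 0 < n := exp_pos _
  have hn1 : n ≤ 1 := by rw [hn, exp_le_one_iff]; nlinarith
  have hδn : δ ≤ n := hδT.trans (by rw [hn]; gcongr 1; nlinarith)
  have hsl : ∀ w ∈ O, (t, w) ∈ parQ T O := fun w hw => ⟨⟨ht0, htT⟩, hw⟩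
  have d1 : ∀ w ∈ O, DifferentiableAt ℝ (fun z => u₁ (t, z)) w :=
    fun w hw => hu₁d.2.2.1 (t, w) (hsl w hw)
  have d2 : ∀ w ∈ O, DifferentiableAt ℝ (fun z => u₂ (t, z)) w :=
    fun w hw => hu₂d.2.2.1 (t, w) (hsl w hw)
  have dd1 := hu₁d.2.2.2.2.1 (t, (x, y)) (hsl _ hz)
  have dd2 := hu₂d.2.2.2.2.1 (t, (x, y)) (hsl _ hz)
  simp only at dd1 dd2
  set B1 := fderiv ℝ (fun z => fderiv ℝ (fun z' => u₁ (t, z')) z) (x, y) with hB1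
  set B2 := fderiv ℝ (fun z => fderiv ℝ (fun z' => u₂ (t, z')) z) (x, y) with hB2
  set G1 := fderiv ℝ (fun z' => u₁ (t, z')) (x, y) with hG1
  set G2 := fderiv ℝ (fun z' => u₂ (t, z')) (x, y) with hG2
  -- spatial conditions at the maximum
  have spatial : ∀ a b : ℝ, E * (G1 (a, b) - G2 (a, b)) - η * barS1 δ M n a b x y = 0 ∧
      E * (B1 (a, b) (a, b) - B2 (a, b) (a, b)) - η * barS2 δ M n a b x y ≤ 0 := by
    intro a b
    obtain ⟨s1, s1'⟩ := slice_deriv hO hz d1 dd1 (a, b)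
    obtain ⟨s2, s2'⟩ := slice_deriv hO hz d2 dd2 (a, b)
    obtain ⟨s3, s3'⟩ := barS_deriv δ M n a b x y hy
    have hm : IsLocalMax (fun s : ℝ => E * (u₁ (t, (x, y) + s • (a, b)) - u₂ (t, (x, y) + s • (a, b)))
        - η * (barS δ M n (x + s * a) (y + s * b) + K + 1 / t)) 0 := by
      have hc : ContinuousAt (fun s : ℝ => ((x, y) : ℝ × ℝ) + s • (a, b)) 0 := by fun_prop
      have hev : ∀ᶠ s in nhds (0 : ℝ), ((x, y) : ℝ × ℝ) + s • (a, b) ∈ O := by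
        apply hc.eventually_mem
        simpa using hO.mem_nhds hz
      filter_upwards [hev] with s hs
      have := hmax (t, (x, y) + s • (a, b)) (hsl _ hs)
      simpa [hE, hn] using this
    have hd1 : ∀ᶠ s in nhds (0 : ℝ), HasDerivAt
        (fun s : ℝ => E * (u₁ (t, (x, y) + s • (a, b)) - u₂ (t, (x, y) + s • (a, b)))
        - η * (barS δ M n (x + s * a) (y + s * b) + K + 1 / t))
        (E * (fderiv ℝ (fun z' => u₁ (t, z')) ((x, y) + s • (a, b)) (a, b)
          - fderiv ℝ (fun z' => u₂ (t, z')) ((x, y) + s • (a, b)) (a, b))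
          - η * barS1 δ M n a b (x + s * a) (y + s * b)) s := by
      filter_upwards [s1, s2, s3] with s h1 h2 h3
      exact ((h1.sub h2).const_mul E).sub (((h3.add_const K).add_const (1 / t)).const_mul η)
    have hd2 := ((s1'.sub s2').const_mul E).sub (s3'.const_mul η)
    have := local_max_second hm hd1 hd2
    simpa using this
  -- time condition
  have temporal : E * (l * (u₁ (t, (x, y)) - u₂ (t, (x, y))) + (Dt u₁ (t, (x, y)) - Dt u₂ (t, (x, y))))
      + η * (L * n * y * (exp ((1 + δ) * x + n * y) + exp (-δ * x + n * y)) + 1 / t ^ 2) = 0 := by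
    have t1 : HasDerivAt (fun s => u₁ (s, (x, y))) (Dt u₁ (t, (x, y))) t :=
      (hu₁d.1 (t, (x, y)) (hsl _ hz)).hasDerivAt
    have t2 : HasDerivAt (fun s => u₂ (s, (x, y))) (Dt u₂ (t, (x, y))) t :=
      (hu₂d.1 (t, (x, y)) (hsl _ hz)).hasDerivAt
    have hm : IsLocalMax (fun s : ℝ => exp (l * (s - T)) * (u₁ (s, (x, y)) - u₂ (s, (x, y)))
        - η * (barS δ M (exp (-L * s)) x y + K + 1 / s)) t := by
      filter_upwards [Ioo_mem_nhds ht0 htT] with s hs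
      exact hmax (s, (x, y)) ⟨hs, hz⟩
    have e1 : HasDerivAt (fun s : ℝ => exp (l * (s - T))) (E * l) t := by
      have := (((hasDerivAt_id t).sub_const T).const_mul l).exp
      simpa [hE] using this
    have e2 : HasDerivAt (fun s : ℝ => exp (-L * s)) (n * (-L)) t := by
      have := ((hasDerivAt_id t).const_mul (-L)).exp
      simpa [hn] using this
    have e3 : ∀ c : ℝ, HasDerivAt (fun s : ℝ => exp (c + exp (-L * s) * y))
        (exp (c + n * y) * (n * (-L) * y)) t := fun c =>
      ((e2.mul_const y).const_add c).exp
    have e4 : HasDerivAt (fun s : ℝ => 1 / s) (-1 / t ^ 2) t := by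
      have := hasDerivAt_inv ht0.ne'
      simp only [one_div]
      exact this.congr_deriv (by ring)
    have hd := (e1.mul (t1.sub t2)).sub ((((((e3 ((1 + δ) * x)).add (e3 (-δ * x))).add_const
      (2 * exp (M * y))).sub_const (log y)).add_const K |>.add e4).const_mul η)
    have := hm.hasDerivAt_eq_zero hd
    rw [← this]
    simp only [Pi.sub_apply]
    ring
  have hA1 := hestonA_eq σ ρ κ θ q r hO hz d1 dd1
  have hA2 := hestonA_eq σ ρ κ θ q r hO hz d2 dd2
  have hP1 : hestonP σ ρ κ θ q r u₁ (t, (x, y)) = _ := hA1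
  have hP2 : hestonP σ ρ κ θ q r u₂ (t, (x, y)) = _ := hA2
  rw [hP1, hP2] at hsub
  simp only [← hB1, ← hB2, ← hG1, ← hG2] at hsub
  have hsup := barrier_super (x := x) (q := q) (r := r) hσ hρ₁ hρ₂ hκ hθ hβ hnp hn1 hy ht0 hδ hδ1
    hδn hM hMμ (hK y hy) hL hl
  obtain ⟨x1, -⟩ := spatial 1 0
  obtain ⟨y1, y2⟩ := spatial 0 1
  obtain ⟨-, w2⟩ := spatial 1 (ρ * σ)
  have hsub' := mul_le_mul_of_nonneg_left hsub hEp.le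
  have hsup' := mul_pos hη hsup
  have hlr : 0 ≤ l + r := by
    have := abs_nonneg (r - q); have : 0 < κ * θ := by positivity
    have : 0 < κ * θ * M := by positivity
    linarith
  have z1 := mul_nonneg hlr hpos.le
  have hρ : 0 ≤ σ ^ 2 * (1 - ρ ^ 2) := mul_nonneg (sq_nonneg _) (by nlinarith)
  have z2 := mul_nonneg hy.le (mul_nonneg hρ (neg_nonneg.mpr y2))
  have z3 := mul_nonneg hy.le (neg_nonneg.mpr w2)
  have x1' := congrArg (fun v => (r - q - y / 2) * v) x1
  have y1' := congrArg (fun v => κ * (θ - y) * v) y1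
  beta_reduce at x1' y1'
  linarith

/-- Comparison: a solution lies below any other solution with the same boundary data. -/
lemma heston_le
    (σ ρ κ θ q r : ℝ) (hσ : σ ≠ 0) (hρ₁ : -1 < ρ) (hρ₂ : ρ < 1)
    (hκ : 0 < κ) (hθ : 0 < θ)
    (hβ : 1 ≤ 2 * κ * θ / σ ^ 2)
    (O : Set (ℝ × ℝ)) (hO : IsOpen O) (hOsub : O ⊆ HH)
    (T : ℝ) (hT : 0 < T)
    (f ψ u₁ u₂ : ℝ × (ℝ × ℝ) → ℝ)
    (hu₁c : ContinuousOn u₁ (parQ T O ∪ parB1 T O)) (hu₁d : C2Parab (parQ T O) u₁)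
    (hu₁g : parabGrowth σ κ (parQ T O) u₁)
    (hu₁eq : parabObstacleProblem σ ρ κ θ q r (parQ T O) f ψ u₁)
    (hu₂c : ContinuousOn u₂ (parQ T O ∪ parB1 T O)) (hu₂d : C2Parab (parQ T O) u₂)
    (hu₂g : parabGrowth σ κ (parQ T O) u₂)
    (hu₂eq : parabObstacleProblem σ ρ κ θ q r (parQ T O) f ψ u₂)
    (hb : ∀ p ∈ parB1 T O, u₁ p = u₂ p) :
    ∀ p ∈ parQ T O ∪ parB1 T O, u₁ p ≤ u₂ p := by
  intro p₀ hp₀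
  by_contra hlt
  push Not at hlt
  obtain ⟨C, M₁, M₂, hC, hM₁, hM₁μ, hM₂, hM₂', hg1⟩ := hu₁g
  obtain ⟨C', M₁', M₂', hC', hM₁', hM₁μ', hM₂0, hM₂1, hg2⟩ := hu₂g
  -- parameters
  set N := max M₁ M₁' with hN
  have hN0 : 0 ≤ N := hM₁.trans (le_max_left _ _)
  have hNμ : N < 2 * κ / σ ^ 2 := max_lt hM₁μ hM₁μ'
  obtain ⟨M, hNM, hMμ⟩ := exists_between hNμ
  have hM : 0 < M := by linarith
  obtain ⟨L, hL⟩ : ∃ L, L = 1 + 2 * |ρ * σ| + σ ^ 2 := ⟨_, rfl⟩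
  have hLp : 0 < L := by rw [hL]; positivity
  obtain ⟨δ, hδ⟩ : ∃ δ, δ = exp (-L * T) / 2 := ⟨_, rfl⟩
  have hδ0 : 0 < δ := by rw [hδ]; positivity
  have hδT : δ ≤ exp (-L * T) := by rw [hδ]; linarith [exp_pos (-L * T)]
  have hδ1 : δ ≤ 1 / 2 := by
    have : exp (-L * T) ≤ 1 := by rw [exp_le_one_iff]; nlinarith
    rw [hδ]; linarith
  obtain ⟨K, hKdef⟩ : ∃ K, K = -1 - log M := ⟨_, rfl⟩
  have hK : ∀ y : ℝ, 0 < y → 1 ≤ exp (M * y) - log y + K := by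
    intro y hy; rw [hKdef]; exact log_bound hM y hy
  obtain ⟨l, hldef⟩ : ∃ l, l = |r| + 2 * |r - q| + κ * θ + 2 * κ * θ * M + κ + 1 := ⟨_, rfl⟩
  have hl : 2 * |r - q| + κ * θ + 2 * κ * θ * M + κ + 1 ≤ l + r := by
    rw [hldef]; linarith [neg_abs_le r]
  have hl0 : 0 ≤ l := by rw [hldef]; positivity
  -- the barrier
  obtain ⟨W, hW⟩ : ∃ W : ℝ × (ℝ × ℝ) → ℝ, ∀ z, W z =
    barS δ M (exp (-L * z.1)) z.2.1 z.2.2 + K + 1 / z.1 := ⟨_, fun _ => rfl⟩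
  have hS := parS_eq hT O hOsub
  have hWpos : ∀ z ∈ parQ T O ∪ parB1 T O, 0 < W z := by
    intro z hz
    rw [hS] at hz
    have h1 : 0 < z.1 := hz.1.1
    have h2 : 0 < z.2.2 := hz.2.2
    rw [hW]; unfold barS
    have := hK _ h2
    have : 0 < 1 / z.1 := by positivity
    have := exp_pos ((1 + δ) * z.2.1 + exp (-L * z.1) * z.2.2)
    have := exp_pos (-δ * z.2.1 + exp (-L * z.1) * z.2.2)
    have := exp_pos (M * z.2.2)
    linarith
  have hE0 : 0 < exp (l * (p₀.1 - T)) * (u₁ p₀ - u₂ p₀) :=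
    mul_pos (exp_pos _) (by linarith)
  obtain ⟨η, hη⟩ : ∃ η, η = exp (l * (p₀.1 - T)) * (u₁ p₀ - u₂ p₀) / (2 * W p₀) := ⟨_, rfl⟩
  have hWp := hWpos p₀ hp₀
  have hη0 : 0 < η := by rw [hη]; positivity
  have hη1 : η * W p₀ = exp (l * (p₀.1 - T)) * (u₁ p₀ - u₂ p₀) / 2 := by
    rw [hη]; field_simp
  obtain ⟨v, hv⟩ : ∃ v : ℝ × (ℝ × ℝ) → ℝ, ∀ z, v z =
    exp (l * (z.1 - T)) * (u₁ z - u₂ z) - η * W z := ⟨_, fun _ => rfl⟩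
  have hv0 : 0 < v p₀ := by rw [hv, hη1]; linarith
  -- positivity forces the point into `Q`
  have hvQ : ∀ z ∈ parQ T O ∪ parB1 T O, 0 < v z → z ∈ parQ T O := by
    intro z hz hpos
    rcases hz with h | h
    · exact h
    · exfalso
      have := hWpos z (Or.inr h)
      rw [hv, hb z h] at hpos
      nlinarith
  obtain ⟨R, hR, hbox⟩ := box_bound (C := 2 * (C + C')) (K := K) (by positivity) hN0 hNM hδ0 hη0 hK
  set Bx : Set (ℝ × (ℝ × ℝ)) :=
    Icc (1 / R) T ×ˢ (closure O ∩ (Icc (-R) R ×ˢ Icc (exp (-R)) R)) with hBx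
  have hBcomp : IsCompact Bx :=
    isCompact_Icc.prod ((isCompact_Icc.prod isCompact_Icc).inter_left isClosed_closure)
  have hBS : Bx ⊆ parQ T O ∪ parB1 T O := by
    rw [hS]
    rintro ⟨t, x, y⟩ ⟨⟨h1, h2⟩, h3, h4, h5, h6⟩
    exact ⟨⟨lt_of_lt_of_le (by positivity) h1, h2⟩, h3, lt_of_lt_of_le (exp_pos _) h5⟩
  have hin : ∀ z ∈ parQ T O ∪ parB1 T O, 0 < v z → z ∈ Bx := by
    intro z hz hpos
    have hzQ := hvQ z hz hpos
    have hy : 0 < z.2.2 := hOsub hzQ.2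
    have ht : 0 < z.1 := hzQ.1.1
    have hE1 : exp (l * (z.1 - T)) ≤ 1 := by
      rw [exp_le_one_iff]
      have := hzQ.1.2
      nlinarith
    have hineq : η * (barS δ M (exp (-L * z.1)) z.2.1 z.2.2 + K + 1 / z.1)
        < 2 * (C + C') * (1 + exp (N * z.2.2) + exp z.2.1) := by
      rw [← hW]
      rw [hv] at hpos
      calc η * W z < exp (l * (z.1 - T)) * (u₁ z - u₂ z) := by linarith
        _ ≤ exp (l * (z.1 - T)) * (|u₁ z| + |u₂ z|) := by
          gcongr; linarith [le_abs_self (u₁ z), neg_abs_le (u₂ z)]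
        _ ≤ 1 * (|u₁ z| + |u₂ z|) := by gcongr
        _ ≤ C * (1 + exp (M₁ * z.2.2) + exp (M₂ * z.2.1))
            + C' * (1 + exp (M₁' * z.2.2) + exp (M₂' * z.2.1)) := by
          rw [one_mul]; exact add_le_add (hg1 z hzQ) (hg2 z hzQ)
        _ ≤ _ := growth_combine hC hC' (le_max_left _ _) (le_max_right _ _) hy hM₂ hM₂' hM₂0 hM₂1
    obtain ⟨b1, b2, b3, b4, b5⟩ := hbox _ _ _ _ ht hy (exp_pos _).le hineq
    exact ⟨⟨b1, hzQ.1.2.le⟩, subset_closure hzQ.2, ⟨b2, b3⟩, ⟨b4, b5⟩⟩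
  have hvc : ContinuousOn v Bx := by
    have hWc : ContinuousOn W Bx := by
      have : ContinuousOn (fun z : ℝ × (ℝ × ℝ) =>
          barS δ M (exp (-L * z.1)) z.2.1 z.2.2 + K + 1 / z.1) Bx := by
        unfold barS
        have hl : ContinuousOn (fun z : ℝ × (ℝ × ℝ) => log z.2.2) Bx := by
          apply ContinuousOn.log (by fun_prop)
          intro z hz
          exact (lt_of_lt_of_le (exp_pos _) hz.2.2.2.1).ne'
        have hi : ContinuousOn (fun z : ℝ × (ℝ × ℝ) => 1 / z.1) Bx := by
          apply ContinuousOn.div (by fun_prop) (by fun_prop)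
          intro z hz
          exact (lt_of_lt_of_le (by positivity : 0 < 1 / R) hz.1.1).ne'
        fun_prop
      exact this.congr fun z _ => hW z
    have h1 := hu₁c.mono hBS
    have h2 := hu₂c.mono hBS
    have : ContinuousOn (fun z => exp (l * (z.1 - T)) * (u₁ z - u₂ z) - η * W z) Bx := by
      fun_prop
    exact this.congr fun z _ => hv z
  obtain ⟨p, hpB, hpmax⟩ := hBcomp.exists_isMaxOn ⟨p₀, hin p₀ hp₀ hv0⟩ hvc
  have hvp : 0 < v p := hv0.trans_le (hpmax (hin p₀ hp₀ hv0))
  have hpQ := hvQ p (hBS hpB) hvp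
  have hmaxQ : ∀ z ∈ parQ T O, v z ≤ v p := by
    intro z hz
    by_cases h : 0 < v z
    · exact hpmax (hin z (Or.inl hz) h)
    · linarith
  have hu : u₂ p < u₁ p := by
    have hWp' := hWpos p (Or.inl hpQ)
    have h1 : 0 < exp (l * (p.1 - T)) * (u₁ p - u₂ p) := by
      rw [hv] at hvp
      have := mul_pos hη0 hWp'
      linarith
    have := (mul_pos_iff_of_pos_left (exp_pos _)).mp h1
    linarith
  have hsub : -Dt u₁ p + hestonP σ ρ κ θ q r u₁ p ≤ -Dt u₂ p + hestonP σ ρ κ θ q r u₂ p := by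
    obtain ⟨a1, a2, a3⟩ := hu₁eq p hpQ
    obtain ⟨b1, b2, b3⟩ := hu₂eq p hpQ
    rcases a3 with h | h
    · linarith
    · linarith
  simp only [hv, hW] at hvp hmaxQ
  exact no_interior_max hσ hρ₁ hρ₂ hκ hθ hβ hδ0 hδ1 hδT hM hMμ hK hL hl hη0 hO hOsub hu₁d hu₂d hpQ
    hsub hvp hmaxQ

/-- Uniqueness of solutions to the parabolic Heston obstacle problem when `β ≥ 1`. -/
theorem heston_parabolic_obstacle_uniqueness_beta_ge_one
    (σ ρ κ θ q r : ℝ) (hσ : σ ≠ 0) (hρ₁ : -1 < ρ) (hρ₂ : ρ < 1)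
    (hκ : 0 < κ) (hθ : 0 < θ)
    (hβ : 1 ≤ 2 * κ * θ / σ ^ 2)
    (O : Set (ℝ × ℝ)) (hO : IsOpen O) (hOconn : IsConnected O) (hOsub : O ⊆ HH)
    (hΓ₀ : (Gamma0 O).Nonempty)
    (T : ℝ) (hT : 0 < T)
    (f ψ g u₁ u₂ : ℝ × (ℝ × ℝ) → ℝ)
    (hf : ContinuousOn f (parQ T O)) (hfg : parabGrowth σ κ (parQ T O) f)
    (hψ : ContinuousOn ψ (parQ T O ∪ parB1 T O))
    (hψg : parabGrowth σ κ (parQ T O ∪ parB1 T O) ψ)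
    (hg : ContinuousOn g (parB1 T O)) (hgg : parabGrowth σ κ (parB1 T O) g)
    (hψle : ∀ p ∈ parB1 T O, ψ p ≤ g p)
    (hu₁c : ContinuousOn u₁ (parQ T O ∪ parB1 T O)) (hu₁d : C2Parab (parQ T O) u₁)
    (hu₁g : parabGrowth σ κ (parQ T O) u₁)
    (hAu₁g : parabGrowth σ κ (parQ T O) (hestonP σ ρ κ θ q r u₁))
    (hu₁eq : parabObstacleProblem σ ρ κ θ q r (parQ T O) f ψ u₁)
    (hu₁b : ∀ p ∈ parB1 T O, u₁ p = g p)
    (hu₂c : ContinuousOn u₂ (parQ T O ∪ parB1 T O)) (hu₂d : C2Parab (parQ T O) u₂)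
    (hu₂g : parabGrowth σ κ (parQ T O) u₂)
    (hAu₂g : parabGrowth σ κ (parQ T O) (hestonP σ ρ κ θ q r u₂))
    (hu₂eq : parabObstacleProblem σ ρ κ θ q r (parQ T O) f ψ u₂)
    (hu₂b : ∀ p ∈ parB1 T O, u₂ p = g p) :
    EqOn u₁ u₂ (parQ T O ∪ parB1 T O) := by
  intro p hp
  apply le_antisymm
  · exact heston_le σ ρ κ θ q r hσ hρ₁ hρ₂ hκ hθ hβ O hO hOsub T hT f ψ u₁ u₂ hu₁c hu₁d hu₁g hu₁eq
      hu₂c hu₂d hu₂g hu₂eq (fun z hz => (hu₁b z hz).trans (hu₂b z hz).symm) p hp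
  · exact heston_le σ ρ κ θ q r hσ hρ₁ hρ₂ hκ hθ hβ O hO hOsub T hT f ψ u₂ u₁ hu₂c hu₂d hu₂g hu₂eq
      hu₁c hu₁d hu₁g hu₁eq (fun z hz => (hu₂b z hz).trans (hu₁b z hz).symm) p hp

end
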